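/- arXiv:2508.11465 — 9 statements merged into one kernel-verified Lean document; each statement's English description precedes it below -/
import Mathlib

section
/- Let C be a small, locally finite category. Then the following are equivalent: (1) every functor D : Cᵒᵖ ⥤ Type whose value D(X) at every object X is a finite nonempty set has a solution (i.e., the set of sections of D is nonempty); (2) C is confluent and has the Ramsey property. -/
open CategoryTheory Opposite

universe v u

/-- A category is confluent if any two objects connected by a zigzag admit a cocone. -/
def Confluent (C : Type u) [Category.{v} C] : Prop :=
  ∀ A B : C, Zigzag A B → ∃ (Z : C) (_ : A ⟶ Z) (_ : B ⟶ Z), True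

/-- The Ramsey property of a category. -/
def RamseyProp (C : Type u) [Category.{v} C] : Prop :=
  ∀ (A B : C) (N : Type) (_ : Finite N), ∃ Z : C,
    ∀ χ : (A ⟶ Z) → N, ∃ g : B ⟶ Z,
      ∀ f f' : A ⟶ B, χ (f ≫ g) = χ (f' ≫ g)

section

variable {C : Type} [SmallCategory C]

/-- The presheaf of the labels `true` and `false` that distinguish the objects above `A` from the
objects above `B`: the former only allow `true`, the latter only `false`. -/
def separatingPresheaf (A B : C) : Cᵒᵖ ⥤ Type where
  obj X := {s : Bool // (Nonempty (A ⟶ X.unop) → s = true) ∧ (Nonempty (B ⟶ X.unop) → s = false)}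
  map f := ↾fun s => ⟨s.1, fun ⟨a⟩ => s.2.1 ⟨a ≫ f.unop⟩, fun ⟨b⟩ => s.2.2 ⟨b ≫ f.unop⟩⟩

/-- The presheaf of the colorings of `A ⟶ Z` that are not constant along any arrow `B ⟶ Z`. -/
def badColorings (A B : C) (N : Type) : Cᵒᵖ ⥤ Type where
  obj Z := {χ : (A ⟶ Z.unop) → N //
    ¬ ∃ g : B ⟶ Z.unop, ∀ f f' : A ⟶ B, χ (f ≫ g) = χ (f' ≫ g)}
  map h := ↾fun χ => ⟨fun f => χ.1 (f ≫ h.unop), fun ⟨g, hg⟩ =>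
    χ.2 ⟨g ≫ h.unop, fun f f' => by simpa using hg f f'⟩⟩

theorem confluent_of_sections_nonempty
    (h : ∀ D : Cᵒᵖ ⥤ Type, (∀ X : Cᵒᵖ, Finite (D.obj X)) → (∀ X : Cᵒᵖ, Nonempty (D.obj X)) →
      D.sections.Nonempty) : Confluent C := by
  intro A B hAB
  by_contra hZ
  obtain ⟨x, hx⟩ := h (separatingPresheaf A B) (fun X => Subtype.finite) (fun X => by
    by_cases hA : Nonempty (A ⟶ X.unop)
    · exact ⟨⟨true, fun _ => rfl, fun ⟨b⟩ => (hZ ⟨X.unop, hA.some, b, trivial⟩).elim⟩⟩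
    · exact ⟨⟨false, fun a => (hA a).elim, fun _ => rfl⟩⟩)
  have hom_eq : ∀ {X Y : C} (_ : X ⟶ Y), (x (op X)).1 = (x (op Y)).1 := fun f =>
    (congrArg Subtype.val (hx f.op)).symm
  have zigzag_eq : ∀ {Y : C}, Zigzag A Y → (x (op A)).1 = (x (op Y)).1 := by
    intro Y hY
    induction hY with
    | refl => rfl
    | tail _ hzag ih =>
      rcases hzag with ⟨⟨f⟩⟩ | ⟨⟨f⟩⟩
      · exact ih.trans (hom_eq f)
      · exact ih.trans (hom_eq f).symm
  have hA := (x (op A)).2.1 ⟨𝟙 A⟩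
  have hB := (x (op B)).2.2 ⟨𝟙 B⟩
  rw [zigzag_eq hAB, hB] at hA
  exact Bool.false_ne_true hA

theorem ramseyProp_of_sections_nonempty (hlf : ∀ A B : C, Finite (A ⟶ B))
    (h : ∀ D : Cᵒᵖ ⥤ Type, (∀ X : Cᵒᵖ, Finite (D.obj X)) → (∀ X : Cᵒᵖ, Nonempty (D.obj X)) →
      D.sections.Nonempty) : RamseyProp C := by
  intro A B N _
  by_contra! hZ
  obtain ⟨x, hx⟩ := h (badColorings A B N)
    (fun Z => by have := hlf A Z.unop; exact Subtype.finite)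
    (fun Z => by
      obtain ⟨χ, hχ⟩ := hZ Z.unop
      exact ⟨⟨χ, fun ⟨g, hg⟩ => by obtain ⟨f, f', hff'⟩ := hχ g; exact hff' (hg f f')⟩⟩)
  have color_eq : ∀ f : A ⟶ B, (x (op B)).1 f = (x (op A)).1 (𝟙 A) := fun f => by
    rw [← hx f.op]
    exact congrArg (x (op B)).1 (Category.id_comp f).symm
  exact (x (op B)).2 ⟨𝟙 B, fun f f' => by rw [color_eq, color_eq]⟩

/-- In a confluent category, finitely many objects of one connected component have a common
upper bound. -/
theorem Confluent.exists_bound (hC : Confluent C) (F : Finset C) (c : C) :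
    ∃ B : C, Zigzag c B ∧ ∀ A ∈ F, Zigzag c A → Nonempty (A ⟶ B) := by
  classical
  induction F using Finset.induction_on with
  | empty => exact ⟨c, .refl c, by simp⟩
  | insert A F _ ih =>
    obtain ⟨B, hB, hF⟩ := ih
    by_cases hA : Zigzag c A
    · obtain ⟨Z, a, b, -⟩ := hC A B (hA.symm.trans hB)
      refine ⟨Z, hB.trans (.of_hom b), fun A' hA' hc => ?_⟩
      rcases Finset.mem_insert.1 hA' with rfl | hA'
      · exact ⟨a⟩
      · exact ⟨(hF A' hA' hc).some ≫ b⟩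
    · refine ⟨B, hB, fun A' hA' hc => ?_⟩
      rcases Finset.mem_insert.1 hA' with rfl | hA'
      · exact (hA hc).elim
      · exact hF A' hA' hc

/-- In a category with the Ramsey property, a presheaf of finite nonempty sets has over every
object `B` an element whose restriction to `A` does not depend on the arrow `A ⟶ B`, for finitely
many given objects `A`. -/
theorem RamseyProp.exists_restriction_eq (hC : RamseyProp C) (D : Cᵒᵖ ⥤ Type)
    [∀ X, Finite (D.obj X)] [∀ X, Nonempty (D.obj X)] (F : Finset C) (B : C) :
    ∃ y : D.obj (op B), ∀ A ∈ F, ∀ f f' : A ⟶ B, D.map f.op y = D.map f'.op y := by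
  classical
  induction F using Finset.induction_on generalizing B with
  | empty => exact ⟨Classical.arbitrary _, by simp⟩
  | insert A F _ ih =>
    obtain ⟨Z, hZ⟩ := hC A B (D.obj (op A)) inferInstance
    obtain ⟨z, hz⟩ := ih Z
    obtain ⟨g, hg⟩ := hZ fun f => D.map f.op z
    refine ⟨D.map g.op z, fun A' hA' f f' => ?_⟩
    rw [← Functor.map_comp_apply, ← Functor.map_comp_apply, ← op_comp, ← op_comp]
    rcases Finset.mem_insert.1 hA' with rfl | hA'
    · exact hg f f'
    · exact hz A' hA' _ _

/-- In a confluent category with the Ramsey property, a presheaf of finite nonempty sets has a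
family of elements compatible with all arrows between finitely many given objects. -/
theorem exists_compatible_on_finset (hconf : Confluent C) (hram : RamseyProp C) (D : Cᵒᵖ ⥤ Type)
    [∀ X, Finite (D.obj X)] [∀ X, Nonempty (D.obj X)] (F : Finset C) :
    ∃ x : ∀ X : Cᵒᵖ, D.obj X, ∀ A ∈ F, ∀ A' ∈ F, ∀ f : A ⟶ A',
      D.map f.op (x (op A')) = x (op A) := by
  choose B _ hF using hconf.exists_bound F
  choose y hy using fun c => hram.exists_restriction_eq D F (B c)
  have restriction : ∀ (c : C) (A : C), ∃ x : D.obj (op A), A ∈ F → ∀ f : A ⟶ B c,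
      D.map f.op (y c) = x := by
    intro c A
    by_cases hA : Nonempty (A ⟶ B c)
    · exact ⟨D.map hA.some.op (y c), fun hAF f => hy c A hAF _ _⟩
    · exact ⟨Classical.arbitrary _, fun _ f => (hA ⟨f⟩).elim⟩
  choose x hx using restriction
  let r : C → C := fun A => (Quotient.mk (Zigzag.setoid C) A).out
  have zigzag_r : ∀ A, Zigzag (r A) A := fun A => Quotient.mk_out (s := Zigzag.setoid C) A
  refine ⟨fun X => x (r X.unop) X.unop, fun A hA A' hA' f => ?_⟩
  have hr : r A = r A' :=
    congrArg Quotient.out (Quotient.sound (s := Zigzag.setoid C) (Zigzag.of_hom f))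
  obtain ⟨g⟩ := hF (r A') A' hA' (zigzag_r A')
  change D.map f.op (x (r A') A') = x (r A) A
  rw [hr, ← hx (r A') A' hA' g, ← hx (r A') A hA (f ≫ g), op_comp, Functor.map_comp_apply]

theorem sections_nonempty_of_confluent_of_ramseyProp (hconf : Confluent C) (hram : RamseyProp C)
    (D : Cᵒᵖ ⥤ Type) [∀ X, Finite (D.obj X)] [∀ X, Nonempty (D.obj X)] :
    D.sections.Nonempty := by
  classical
  let _ : ∀ X, TopologicalSpace (D.obj X) := fun _ => ⊥
  have : ∀ X, DiscreteTopology (D.obj X) := fun _ => ⟨rfl⟩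
  let S : Finset C → Set (∀ X, D.obj X) := fun F =>
    {x | ∀ A ∈ F, ∀ A' ∈ F, ∀ f : A ⟶ A', D.map f.op (x (op A')) = x (op A)}
  have S_closed : ∀ F, IsClosed (S F) := fun F => by
    simp only [S, Set.ofPred_forall]
    refine isClosed_iInter fun A => isClosed_iInter fun _ => isClosed_iInter fun A' =>
      isClosed_iInter fun _ => isClosed_iInter fun f => isClosed_eq ?_ (continuous_apply _)
    exact continuous_of_discreteTopology.comp (continuous_apply (op A'))
  have S_antitone : Antitone S := fun F G hFG x hx A hA A' hA' => hx A (hFG hA) A' (hFG hA')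
  obtain ⟨x, hx⟩ := IsCompact.nonempty_iInter_of_directed_nonempty_isCompact_isClosed S
    S_antitone.directed_ge (exists_compatible_on_finset hconf hram D)
    (fun F => (S_closed F).isCompact) S_closed
  refine ⟨x, fun {X Y} f => ?_⟩
  exact Set.mem_iInter.1 hx {X.unop, Y.unop} Y.unop (by simp) X.unop (by simp) f.unop

end

theorem konig_iff_ramsey (C : Type) [SmallCategory C]
    (hlf : ∀ A B : C, Finite (A ⟶ B)) :
    (∀ D : Cᵒᵖ ⥤ Type,
        (∀ X : Cᵒᵖ, Finite (D.obj X)) → (∀ X : Cᵒᵖ, Nonempty (D.obj X)) →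
          D.sections.Nonempty)
      ↔ (Confluent C ∧ RamseyProp C) := by
  exact ⟨fun h => ⟨confluent_of_sections_nonempty h, ramseyProp_of_sections_nonempty hlf h⟩,
    fun h D _ _ => sections_nonempty_of_confluent_of_ramseyProp h.1 h.2 D⟩
end

section
/- Let C be a small category and let D : Cᵒᵖ ⥤ Type be a functor whose value at every object is a finite set. If D has no solution (its set of sections is empty), then there exists a finite set M of arrows of C such that D has no M-solution. -/
open CategoryTheory Opposite

theorem compactness_lemma (C : Type) [SmallCategory C]
    (D : Cᵒᵖ ⥤ Type)
    (hfin : ∀ X : Cᵒᵖ, Finite (D.obj X))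
    (h : D.sections = ∅) :
    ∃ M : Set (Arrow C), M.Finite ∧
      ¬ ∃ x : ∀ X : C, D.obj (op X),
          ∀ a ∈ M, D.map a.hom.op (x a.right) = x a.left := by
  by_contra! hM
  let (X : Cᵒᵖ) : TopologicalSpace (D.obj X) := ⊥
  have (X : Cᵒᵖ) : DiscreteTopology (D.obj X) := ⟨rfl⟩
  have hclosed (a : Arrow C) :
      IsClosed {x : ∀ X : C, D.obj (op X) | D.map a.hom.op (x a.right) = x a.left} :=
    isClosed_eq (continuous_of_discreteTopology.comp (continuous_apply a.right))
      (continuous_apply a.left)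
  obtain ⟨x, hx⟩ := CompactSpace.iInter_nonempty hclosed fun s => by
    obtain ⟨x, hx⟩ := hM s s.finite_toSet
    exact ⟨x, Set.mem_iInter₂.2 hx⟩
  have hsection : (fun X : Cᵒᵖ => x X.unop) ∈ D.sections := fun f =>
    Set.mem_iInter.1 hx (Arrow.mk f.unop)
  simp [h] at hsection
end

section
/- Let π : E ⥤ C and ρ : F ⥤ C be expansions of a category C. If E is small, locally finite, confluent and has the Ramsey property, and ρ is precompact, then there exists a homomorphism of expansions from π to ρ, i.e., a functor α : E ⥤ F with ρ ∘ α = π. -/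
open CategoryTheory Opposite

universe v u v' u'

/-- An (abstract) expansion: a functor that is surjective on objects and a
discrete fibration. -/
structure IsExpansion {E : Type u} {C : Type u'} [Category.{v} E] [Category.{v'} C]
    (π : E ⥤ C) : Prop where
  surj : ∀ c : C, ∃ e : E, π.obj e = c
  fib : ∀ (e : E) (c : C) (f : c ⟶ π.obj e),
    ∃! p : Σ e' : E, e' ⟶ e, ∃ h : π.obj p.1 = c, π.map p.2 = eqToHom h ≫ f

/-- An expansion is precompact if all of its fibers on objects are finite. -/
def Precompact {E : Type u} {C : Type u'} [Category.{v} E] [Category.{v'} C]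
    (π : E ⥤ C) : Prop :=
  ∀ c : C, {e : E | π.obj e = c}.Finite

/-- In a confluent category, finitely many objects of the same connected component admit
arrows to a common object of that component. -/
theorem Confluent.exists_cocone_of_finset {C : Type u} [Category.{v} C] (hC : Confluent C)
    (c : ConnectedComponents C) (s : Finset C) :
    ∃ Z : C, Quotient.mk (Zigzag.setoid C) Z = c ∧
      ∀ A ∈ s, Quotient.mk (Zigzag.setoid C) A = c → Nonempty (A ⟶ Z) := by
  classical
  induction s using Finset.induction_on with
  | empty =>
    obtain ⟨Z, hZ⟩ := Quotient.exists_rep c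
    exact ⟨Z, hZ, by simp⟩
  | insert A s _ ih =>
    obtain ⟨Z, hZ, hs⟩ := ih
    by_cases hA : Quotient.mk (Zigzag.setoid C) A = c
    · obtain ⟨W, a, z, -⟩ := hC A Z (Quotient.exact (hA.trans hZ.symm))
      refine ⟨W, (Quotient.sound (Zigzag.of_inv z)).trans hZ, fun B hB hBc => ?_⟩
      rcases Finset.mem_insert.mp hB with rfl | hB
      · exact ⟨a⟩
      · exact (hs B hB hBc).map (· ≫ z)
    · refine ⟨Z, hZ, fun B hB hBc => ?_⟩
      rcases Finset.mem_insert.mp hB with rfl | hB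
      · exact absurd hBc hA
      · exact hs B hB hBc

/-- Simultaneous form of the Ramsey property: colourings of the arrows out of finitely many
objects, induced by an element of a presheaf with finite values, become constant along a
common arrow. -/
theorem RamseyProp.exists_forall_map_eq {C : Type u} [Category.{v} C] (hC : RamseyProp C)
    (P : Cᵒᵖ ⥤ Type) [∀ X, Finite (P.obj X)] (s : Finset C) (B : C) :
    ∃ Z : C, ∀ z : P.obj (op Z), ∃ g : B ⟶ Z, ∀ A ∈ s, ∀ f f' : A ⟶ B,
      P.map (f ≫ g).op z = P.map (f' ≫ g).op z := by
  classical
  induction s using Finset.induction_on generalizing B with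
  | empty => exact ⟨B, fun _ => ⟨𝟙 B, by simp⟩⟩
  | insert A s _ ih =>
    obtain ⟨B', hB'⟩ := hC A B (P.obj (op A)) inferInstance
    obtain ⟨Z, hZ⟩ := ih B'
    refine ⟨Z, fun z => ?_⟩
    obtain ⟨g', hg'⟩ := hZ z
    obtain ⟨g, hg⟩ := hB' fun f => P.map (f ≫ g').op z
    refine ⟨g ≫ g', fun A' hA' f f' => ?_⟩
    rcases Finset.mem_insert.mp hA' with rfl | hA'
    · simpa only [Category.assoc] using hg f f'
    · simpa only [Category.assoc] using hg' A' hA' (f ≫ g) (f' ≫ g)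

/-- A presheaf with finite nonempty values on a confluent category with the Ramsey property
has a global section. -/
theorem RamseyProp.nonempty_sections {C : Type u} [Category.{v} C] (hC : RamseyProp C)
    (hconf : Confluent C) (P : Cᵒᵖ ⥤ Type) [∀ X, Finite (P.obj X)] [∀ X, Nonempty (P.obj X)] :
    P.sections.Nonempty := by
  classical
  have local_section (s : Finset C) : ∃ x : ∀ A : C, P.obj (op A),
      ∀ A ∈ s, ∀ B ∈ s, ∀ f : A ⟶ B, P.map f.op (x B) = x A := by
    choose Z _ hZ using fun c => hconf.exists_cocone_of_finset c s
    have exists_const (B : C) : ∃ y : P.obj (op B), ∀ A ∈ s, ∀ f f' : A ⟶ B,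
        P.map f.op y = P.map f'.op y := by
      obtain ⟨W, hW⟩ := hC.exists_forall_map_eq P s B
      obtain ⟨w⟩ : Nonempty (P.obj (op W)) := inferInstance
      obtain ⟨g, hg⟩ := hW w
      exact ⟨P.map g.op w, fun A hA f f' => by simpa using hg A hA f f'⟩
    choose y hy using exists_const
    have exists_value (A : C) : ∃ x : P.obj (op A), A ∈ s →
        ∀ f : A ⟶ Z (Quotient.mk _ A), P.map f.op (y _) = x := by
      by_cases h : Nonempty (A ⟶ Z (Quotient.mk _ A))
      · obtain ⟨f⟩ := h
        exact ⟨P.map f.op (y _), fun hA f' => hy _ A hA f' f⟩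
      · exact ⟨Classical.arbitrary _, fun _ f => absurd ⟨f⟩ h⟩
    choose x hx using exists_value
    refine ⟨x, fun A hA B hB f => ?_⟩
    obtain ⟨b⟩ := hZ _ B hB rfl
    have hAB : (Quotient.mk (Zigzag.setoid C) A) = Quotient.mk _ B :=
      Quotient.sound (Zigzag.of_hom f)
    have hxA := hx A hA
    rw [hAB] at hxA
    rw [← hx B hB b, ← hxA (f ≫ b)]
    simp
  choose g hg using local_section
  obtain ⟨x, hx⟩ := Finset.rado_selection g
  refine ⟨fun A => x A.unop, fun {B A} f => ?_⟩
  obtain ⟨t, hst, ht⟩ := hx {A.unop, B.unop}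
  have h := hg t A.unop (hst (by simp)) B.unop (hst (by simp)) f.unop
  rw [← ht A.unop (by simp), ← ht B.unop (by simp)] at h
  exact h

namespace IsExpansion

variable {F : Type u} {C : Type u'} [Category.{v} F] [Category.{v'} C] {ρ : F ⥤ C}

/-- Arrows of the base lift uniquely along an expansion, once the codomain is prescribed. -/
theorem existsUnique_isHomLift (hρ : IsExpansion ρ) {c d : C} (f : c ⟶ d) (y : F)
    (hy : ρ.obj y = d) : ∃! p : Σ x : F, x ⟶ y, ρ.IsHomLift f p.2 := by
  subst hy
  obtain ⟨p, ⟨hp, hpf⟩, huniq⟩ := hρ.fib y c f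
  refine ⟨p, IsHomLift.of_fac' ρ f p.2 hp rfl (by simpa using hpf), fun q hq => ?_⟩
  exact huniq q ⟨IsHomLift.domain_eq ρ f q.2, by simpa using IsHomLift.fac' ρ f q.2⟩

/-- The lift of an arrow of the base with prescribed codomain. -/
noncomputable def lift (hρ : IsExpansion ρ) {c d : C} (f : c ⟶ d) (y : ρ.Fiber d) :
    Σ x : F, x ⟶ y.1 :=
  (hρ.existsUnique_isHomLift f y.1 y.2).choose

instance isHomLift_lift (hρ : IsExpansion ρ) {c d : C} (f : c ⟶ d) (y : ρ.Fiber d) :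
    ρ.IsHomLift f (hρ.lift f y).2 :=
  (hρ.existsUnique_isHomLift f y.1 y.2).choose_spec.1

theorem eq_lift (hρ : IsExpansion ρ) {c d : C} (f : c ⟶ d) (y : ρ.Fiber d) {x : F}
    (φ : x ⟶ y.1) [ρ.IsHomLift f φ] : (⟨x, φ⟩ : Σ x : F, x ⟶ y.1) = hρ.lift f y :=
  (hρ.existsUnique_isHomLift f y.1 y.2).choose_spec.2 ⟨x, φ⟩ ‹_›

theorem hom_ext_of_isHomLift (hρ : IsExpansion ρ) {c d : C} (f : c ⟶ d) {x y : F}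
    (φ ψ : x ⟶ y) [ρ.IsHomLift f φ] [ρ.IsHomLift f ψ] : φ = ψ := by
  have h := (hρ.existsUnique_isHomLift f y (IsHomLift.codomain_eq ρ f φ)).unique
    (y₁ := ⟨x, φ⟩) (y₂ := ⟨x, ψ⟩) ‹_› ‹_›
  simpa using h

/-- The presheaf on the base whose value at an object is the fiber of the expansion over it. -/
noncomputable def fiberPresheaf (hρ : IsExpansion ρ) : Cᵒᵖ ⥤ Type u where
  obj c := ρ.Fiber c.unop
  map f := ↾fun y => ⟨(hρ.lift f.unop y).1, IsHomLift.domain_eq ρ f.unop (hρ.lift f.unop y).2⟩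
  map_id c := by
    ext y
    have : ρ.IsHomLift (𝟙 c.unop) (𝟙 y.1) := IsHomLift.id y.2
    exact Subtype.ext (congrArg Sigma.fst (hρ.eq_lift (𝟙 c.unop) y (𝟙 y.1))).symm
  map_comp {c d e} f g := by
    ext y
    let y' : ρ.Fiber d.unop :=
      ⟨(hρ.lift f.unop y).1, IsHomLift.domain_eq ρ f.unop (hρ.lift f.unop y).2⟩
    exact Subtype.ext (congrArg Sigma.fst (hρ.eq_lift (g.unop ≫ f.unop) y
      ((hρ.lift g.unop y').2 ≫ (hρ.lift f.unop y).2))).symm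

theorem exists_isHomLift_of_fiberPresheaf_map_eq (hρ : IsExpansion ρ) {c d : C} (f : c ⟶ d)
    {x : ρ.Fiber c} {y : ρ.Fiber d} (h : hρ.fiberPresheaf.map f.op y = x) :
    ∃ φ : x.1 ⟶ y.1, ρ.IsHomLift f φ := by
  subst h
  exact ⟨(hρ.lift f y).2, hρ.isHomLift_lift f y⟩

/-- A functor to the base lifts along an expansion as soon as the pulled back presheaf of
fibers has a global section. -/
theorem exists_comp_eq_of_sections_nonempty (hρ : IsExpansion ρ) {E : Type*} [Category* E]
    (π : E ⥤ C) (h : (π.op ⋙ hρ.fiberPresheaf).sections.Nonempty) :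
    ∃ α : E ⥤ F, α ⋙ ρ = π := by
  obtain ⟨x, hx⟩ := h
  let obj (e : E) : ρ.Fiber (π.obj e) := x (op e)
  have exists_map {e e' : E} (f : e ⟶ e') :
      ∃ φ : (obj e).1 ⟶ (obj e').1, ρ.IsHomLift (π.map f) φ :=
    hρ.exists_isHomLift_of_fiberPresheaf_map_eq (π.map f) (hx f.op)
  choose map hmap using @exists_map
  let α : E ⥤ F :=
    { obj := fun e => (obj e).1
      map := map
      map_id := fun e => by
        have : ρ.IsHomLift (π.map (𝟙 e)) (𝟙 (obj e).1) := by
          rw [π.map_id]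
          exact IsHomLift.id (obj e).2
        exact hρ.hom_ext_of_isHomLift (π.map (𝟙 e)) _ _
      map_comp := fun f g => by
        have : ρ.IsHomLift (π.map (f ≫ g)) (map f ≫ map g) := by
          rw [π.map_comp]
          infer_instance
        exact hρ.hom_ext_of_isHomLift (π.map (f ≫ g)) _ _ }
  exact ⟨α, CategoryTheory.Functor.ext (fun e => (obj e).2)
    fun e e' f => IsHomLift.fac' ρ (π.map f) (map f)⟩

end IsExpansion

theorem ramsey_expansion_homomorphism
    (C E F : Type) [SmallCategory C] [SmallCategory E] [SmallCategory F]
    (π : E ⥤ C) (ρ : F ⥤ C)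
    (hπ : IsExpansion π) (hρ : IsExpansion ρ)
    (hlf : ∀ A B : E, Finite (A ⟶ B))
    (hconf : Confluent E) (hram : RamseyProp E)
    (hpre : Precompact ρ) :
    ∃ α : E ⥤ F, α ⋙ ρ = π := by
  have (X : Eᵒᵖ) : Finite ((π.op ⋙ hρ.fiberPresheaf).obj X) := hpre (π.obj X.unop)
  have (X : Eᵒᵖ) : Nonempty ((π.op ⋙ hρ.fiberPresheaf).obj X) :=
    let ⟨y, hy⟩ := hρ.surj (π.obj X.unop)
    ⟨⟨y, hy⟩⟩
  exact hρ.exists_comp_eq_of_sections_nonempty π (hram.nonempty_sections hconf _)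
end

section
/- Let π : E ⥤ C be a precompact expansion of a confluent category C. Then π has the expansion property if and only if every homomorphism of expansions to π (from any expansion ρ : F ⥤ C of C) is surjective on objects. -/
open CategoryTheory Opposite

universe v u v' u'

/-- The expansion property of an expansion. -/
def ExpansionProperty {E : Type u} {C : Type u'} [Category.{v} E] [Category.{v'} C]
    (π : E ⥤ C) : Prop :=
  ∀ c : C, ∃ c' : C, ∀ e e' : E, π.obj e = c → π.obj e' = c' → Nonempty (e ⟶ e')

namespace IsExpansion

variable {E : Type u} {C : Type u'} [Category.{v} E] [Category.{v'} C] {π : E ⥤ C}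

/-- Every arrow into the image of an object lifts along an expansion. -/
theorem exists_lift (hπ : IsExpansion π) {e : E} {c : C} (f : c ⟶ π.obj e) :
    ∃ (e' : E) (g : e' ⟶ e) (h : π.obj e' = c), π.map g = eqToHom h ≫ f := by
  obtain ⟨⟨e', g⟩, ⟨h, hg⟩, -⟩ := hπ.fib e c f
  exact ⟨e', g, h, hg⟩

/-- Two lifts of the same arrow along an expansion agree. -/
theorem lift_unique (hπ : IsExpansion π) {e : E} {c : C} {f : c ⟶ π.obj e}
    {p q : Σ e' : E, e' ⟶ e} (hp : ∃ h : π.obj p.1 = c, π.map p.2 = eqToHom h ≫ f)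
    (hq : ∃ h : π.obj q.1 = c, π.map q.2 = eqToHom h ≫ f) : p = q :=
  (hπ.fib e c f).unique hp hq

/-- The restriction of an expansion to a downward closed class of objects that meets every
fiber is an expansion. -/
theorem restrict (hπ : IsExpansion π) (P : ObjectProperty E)
    (hdown : ∀ ⦃e e' : E⦄, (e ⟶ e') → P e' → P e)
    (hsurj : ∀ c : C, ∃ e, P e ∧ π.obj e = c) :
    IsExpansion (P.ι ⋙ π) where
  surj c := by
    obtain ⟨e, he, rfl⟩ := hsurj c
    exact ⟨⟨e, he⟩, rfl⟩
  fib := by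
    rintro ⟨e, he⟩ c f
    obtain ⟨e', g, h, hg⟩ := hπ.exists_lift (e := e) f
    refine ⟨⟨⟨e', hdown g he⟩, ObjectProperty.homMk g⟩, ⟨h, hg⟩, ?_⟩
    rintro ⟨⟨e'', he''⟩, ⟨k⟩⟩ ⟨h', hk⟩
    have key : (⟨e'', k⟩ : Σ e' : E, e' ⟶ e) = ⟨e', g⟩ := hπ.lift_unique ⟨h', hk⟩ ⟨h, hg⟩
    cases key
    rfl

/-- Homomorphisms into an expansion with the expansion property are surjective on objects. -/
theorem surjective_of_expansionProperty (hπ : IsExpansion π) (hep : ExpansionProperty π)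
    {F : Type*} [Category* F] {α : F ⥤ E} (hα : IsExpansion (α ⋙ π)) :
    Function.Surjective α.obj := by
  intro e
  obtain ⟨c', hc'⟩ := hep (π.obj e)
  obtain ⟨x, hx⟩ := hα.surj c'
  obtain ⟨g⟩ := hc' e (α.obj x) rfl hx
  obtain ⟨x', k, h, hk⟩ := hα.exists_lift (e := x) (π.map g)
  have key : (⟨α.obj x', α.map k⟩ : Σ e' : E, e' ⟶ α.obj x) = ⟨e, g⟩ :=
    hπ.lift_unique ⟨h, hk⟩ ⟨rfl, by simp⟩
  exact ⟨x', congrArg Sigma.fst key⟩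

/-- If for each object over `c` there is a fiber all of whose members it maps to, then
confluence yields a single fiber that works for finitely many objects over `c`. -/
theorem exists_common_fiber (hπ : IsExpansion π) (hconf : Confluent C) {c : C} {T : Set E}
    (hT : T.Finite) (hc : ∀ e ∈ T, π.obj e = c)
    (hfib : ∀ e ∈ T, ∃ c' : C, ∀ e', π.obj e' = c' → Nonempty (e ⟶ e')) :
    ∃ c' : C, Nonempty (c ⟶ c') ∧
      ∀ e ∈ T, ∀ e', π.obj e' = c' → Nonempty (e ⟶ e') := by
  induction T, hT using Set.Finite.induction_on with
  | empty => exact ⟨c, ⟨𝟙 c⟩, by simp⟩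
  | @insert a S _ _ ih =>
    obtain ⟨c₁, ⟨u₁⟩, h₁⟩ := ih (fun e he => hc e (.inr he)) (fun e he => hfib e (.inr he))
    obtain ⟨c₂, h₂⟩ := hfib a (.inl rfl)
    obtain ⟨x, rfl⟩ := hπ.surj c₂
    obtain ⟨w⟩ := h₂ x rfl
    obtain rfl := hc a (.inl rfl)
    obtain ⟨Z, v₁, v₂, -⟩ := hconf c₁ (π.obj x)
      ((Zigzag.of_inv u₁).trans (Zigzag.of_hom (π.map w)))
    refine ⟨Z, ⟨u₁ ≫ v₁⟩, ?_⟩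
    rintro e he y rfl
    rcases he with rfl | he
    · obtain ⟨z, g, hz, -⟩ := hπ.exists_lift v₂
      exact (h₂ z hz).map (· ≫ g)
    · obtain ⟨z, g, hz, -⟩ := hπ.exists_lift v₁
      exact (h₁ e he z hz).map (· ≫ g)

end IsExpansion

theorem expansion_property_iff_all_homs_surjective
    (C E : Type) [SmallCategory C] [SmallCategory E]
    (π : E ⥤ C) (hπ : IsExpansion π) (hpre : Precompact π)
    (hconf : Confluent C) :
    ExpansionProperty π ↔
      ∀ (F : Type) (_ : SmallCategory F) (ρ : F ⥤ C), IsExpansion ρ →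
        ∀ α : F ⥤ E, α ⋙ π = ρ → Function.Surjective α.obj := by
  constructor
  · rintro hep F _ _ hρ α rfl
    exact hπ.surjective_of_expansionProperty hep hρ
  · intro hsurj c
    have hfib (e : E) : ∃ c' : C, ∀ e', π.obj e' = c' → Nonempty (e ⟶ e') := by
      by_contra! hne
      let P : ObjectProperty E := fun e' => IsEmpty (e ⟶ e')
      have hP : IsExpansion (P.ι ⋙ π) := hπ.restrict P
        (fun _ _ g hempty => ⟨fun k => hempty.false (k ≫ g)⟩)
        (fun c' => (hne c').imp fun _ h => ⟨h.2, h.1⟩)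
      obtain ⟨⟨x, hx⟩, hxe : x = e⟩ := hsurj P.FullSubcategory inferInstance _ hP P.ι rfl e
      exact hx.false (eqToHom hxe.symm)
    obtain ⟨c', -, hc'⟩ := hπ.exists_common_fiber hconf (hpre c) (fun _ he => he)
      (fun e _ => hfib e)
    exact ⟨c', fun e e' he he' => hc' e he e' he'⟩
end

section
/- Let C be a small, locally finite, confluent category that admits a precompact expansion π₀ : E₀ ⥤ C with E₀ confluent and Ramsey. Then C admits a precompact expansion π : E ⥤ C with E confluent and Ramsey which has the expansion property; moreover such an expansion is unique up to isomorphism of expansions (any two are related by a homomorphism of expansions that is bijective on objects), and it is minimal: for every precompact expansion ρ : F ⥤ C with F confluent and Ramsey there is a surjective homomorphism of expansions α : F ⥤ E with π ∘ α = ρ. -/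
open CategoryTheory Opposite

universe v u v' u'

/-- There is a lift of `f` along `π` from `e'` to `e`: for an expansion, `e'` is the restriction
of `e` along `f`. -/
def IsRestriction {E : Type u} {C : Type u'} [Category.{v} E] [Category.{v'} C] (π : E ⥤ C)
    {c d : C} (f : c ⟶ d) (e' e : E) : Prop :=
  ∃ φ : e' ⟶ e, π.IsHomLift f φ

namespace IsRestriction

variable {E : Type u} {C : Type u'} [Category.{v} E] [Category.{v'} C] {π : E ⥤ C}

theorem map (π : E ⥤ C) {e' e : E} (φ : e' ⟶ e) : IsRestriction π (π.map φ) e' e :=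
  ⟨φ, inferInstance⟩

theorem obj_eq {c d : C} {f : c ⟶ d} {e' e : E} (h : IsRestriction π f e' e) : π.obj e' = c := by
  obtain ⟨φ, hφ⟩ := h
  exact IsHomLift.domain_eq π f φ

theorem comp {b c d : C} {f : b ⟶ c} {g : c ⟶ d} {x y z : E}
    (h : IsRestriction π f x y) (h' : IsRestriction π g y z) : IsRestriction π (f ≫ g) x z := by
  obtain ⟨φ, hφ⟩ := h
  obtain ⟨ψ, hψ⟩ := h'
  exact ⟨φ ≫ ψ, inferInstance⟩

end IsRestriction

namespace IsExpansion

variable {E : Type u} {C : Type u'} [Category.{v} E] [Category.{v'} C] {π : E ⥤ C}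

theorem exists_isRestriction (hπ : IsExpansion π) {c d : C} (f : c ⟶ d) {e : E}
    (he : π.obj e = d) : ∃ e', IsRestriction π f e' e := by
  subst he
  obtain ⟨⟨e', φ⟩, ⟨h, hφ⟩, -⟩ := hπ.fib e c f
  exact ⟨e', φ, IsHomLift.of_fac' π f φ h rfl (by simpa using hφ)⟩

theorem sigma_eq (hπ : IsExpansion π) {c d : C} {f : c ⟶ d} {e e₁ e₂ : E}
    (φ₁ : e₁ ⟶ e) (φ₂ : e₂ ⟶ e) (h₁ : π.IsHomLift f φ₁) (h₂ : π.IsHomLift f φ₂) :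
    (⟨e₁, φ₁⟩ : Σ e' : E, e' ⟶ e) = ⟨e₂, φ₂⟩ := by
  obtain rfl := IsHomLift.codomain_eq π f φ₁
  exact (hπ.fib e c f).unique
    ⟨IsHomLift.domain_eq π f φ₁, by simpa using IsHomLift.fac' π f φ₁⟩
    ⟨IsHomLift.domain_eq π f φ₂, by simpa using IsHomLift.fac' π f φ₂⟩

theorem isRestriction_unique (hπ : IsExpansion π) {c d : C} {f : c ⟶ d} {e e₁ e₂ : E}
    (h₁ : IsRestriction π f e₁ e) (h₂ : IsRestriction π f e₂ e) : e₁ = e₂ := by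
  obtain ⟨φ₁, h₁⟩ := h₁
  obtain ⟨φ₂, h₂⟩ := h₂
  exact congrArg Sigma.fst (hπ.sigma_eq φ₁ φ₂ h₁ h₂)

theorem hom_ext (hπ : IsExpansion π) {c d : C} (f : c ⟶ d) {e' e : E} {φ₁ φ₂ : e' ⟶ e}
    (h₁ : π.IsHomLift f φ₁) (h₂ : π.IsHomLift f φ₂) : φ₁ = φ₂ := by
  simpa using hπ.sigma_eq φ₁ φ₂ h₁ h₂

/-- A map on objects compatible with restrictions extends to a homomorphism over the base. -/
theorem exists_functor (hπ : IsExpansion π) {F : Type*} [Category* F] (ρ : F ⥤ C) (a : F → E)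
    (ha : ∀ {x y : F} (h : x ⟶ y), IsRestriction π (ρ.map h) (a x) (a y)) :
    ∃ α : F ⥤ E, α ⋙ π = ρ ∧ ∀ x, α.obj x = a x := by
  choose k hk using @ha
  have hobj : ∀ x, π.obj (a x) = ρ.obj x := fun x => IsHomLift.domain_eq π (ρ.map (𝟙 x)) (k (𝟙 x))
  refine ⟨
    { obj := a
      map := fun h => k h
      map_id := fun x => hπ.hom_ext (ρ.map (𝟙 x)) (hk _) ?_
      map_comp := fun {x y z} f g => hπ.hom_ext (ρ.map (f ≫ g)) (hk _) ?_ }, ?_, fun _ => rfl⟩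
  · rw [ρ.map_id]
    exact IsHomLift.id (hobj x)
  · rw [ρ.map_comp]
    have := hk f
    have := hk g
    infer_instance
  · refine CategoryTheory.Functor.ext hobj fun x y h => ?_
    have := hk h
    exact IsHomLift.fac' π (ρ.map h) (k h)

end IsExpansion

theorem isHomLift_map_of_comp_eq {E : Type*} {F : Type*} {C : Type*} [Category* E]
    [Category* F] [Category* C] {π : E ⥤ C} {ρ : F ⥤ C} {α : F ⥤ E} (hα : α ⋙ π = ρ)
    {c d : C} {f : c ⟶ d} {x y : F} {φ : x ⟶ y} (h : ρ.IsHomLift f φ) :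
    π.IsHomLift f (α.map φ) := by
  subst hα
  obtain ⟨⟩ := h
  exact .map (α.map φ)

theorem IsRestriction.map_of_comp_eq {E : Type*} {F : Type*} {C : Type*} [Category* E]
    [Category* F] [Category* C] {π : E ⥤ C} {ρ : F ⥤ C} {α : F ⥤ E} (hα : α ⋙ π = ρ)
    {c d : C} {f : c ⟶ d} {x y : F} (h : IsRestriction ρ f x y) :
    IsRestriction π f (α.obj x) (α.obj y) := by
  obtain ⟨φ, hφ⟩ := h
  exact ⟨α.map φ, isHomLift_map_of_comp_eq hα hφ⟩

/-- The Ramsey property for finitely many objects simultaneously. -/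
theorem RamseyProp.exists_forall_finset {F : Type u} [Category.{v} F] (hF : RamseyProp F)
    (N : F → Type) [∀ A, Finite (N A)] (S : Finset F) (B : F) :
    ∃ Z : F, ∀ χ : ∀ A, (A ⟶ Z) → N A, ∃ g : B ⟶ Z,
      ∀ A ∈ S, ∀ f f' : A ⟶ B, χ A (f ≫ g) = χ A (f' ≫ g) := by
  classical
  induction S using Finset.induction_on with
  | empty => exact ⟨B, fun _ => ⟨𝟙 B, by simp⟩⟩
  | insert A S _ ih =>
    obtain ⟨Y, hY⟩ := ih
    obtain ⟨Z, hZ⟩ := hF A Y (N A) inferInstance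
    refine ⟨Z, fun χ => ?_⟩
    obtain ⟨g, hg⟩ := hZ (χ A)
    obtain ⟨g', hg'⟩ := hY fun X f => χ X (f ≫ g)
    refine ⟨g' ≫ g, fun X hX f f' => ?_⟩
    obtain rfl | hX := Finset.mem_insert.mp hX
    · simpa using hg (f ≫ g') (f' ≫ g')
    · simpa using hg' X hX f f'

theorem Confluent.exists_cocone_finset {F : Type u} [Category.{v} F] (hF : Confluent F) (X : F)
    (S : Finset F) (hS : ∀ A ∈ S, Zigzag X A) :
    ∃ Z : F, Nonempty (X ⟶ Z) ∧ ∀ A ∈ S, Nonempty (A ⟶ Z) := by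
  classical
  induction S using Finset.induction_on with
  | empty => exact ⟨X, ⟨𝟙 X⟩, by simp⟩
  | insert A S _ ih =>
    obtain ⟨Y, ⟨f⟩, hY⟩ := ih fun B hB => hS B (Finset.mem_insert_of_mem hB)
    have hAY : Zigzag A Y :=
      (zigzag_symm.symm _ _ (hS A (Finset.mem_insert_self A S))).trans (Zigzag.of_hom f)
    obtain ⟨Z, g, h, -⟩ := hF A Y hAY
    refine ⟨Z, ⟨f ≫ h⟩, fun B hB => ?_⟩
    obtain rfl | hB := Finset.mem_insert.mp hB
    · exact ⟨g⟩
    · exact (hY B hB).map (· ≫ h)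

section Homomorphism

variable {C : Type u'} [Category.{v'} C] {E : Type} [Category.{v} E] {π : E ⥤ C}
  {F : Type u} [Category.{v} F]

/-- Compatible choices on the finite subdiagrams of `F` lying below a single object. -/
theorem exists_compatible_of_cocone (hπ : IsExpansion π) (hpre : Precompact π) (ρ : F ⥤ C)
    (hram : RamseyProp F) (S : Finset F) (B : F) (hB : ∀ x ∈ S, Nonempty (x ⟶ B)) :
    ∃ a : ∀ x : F, {e : E // π.obj e = ρ.obj x}, ∀ x ∈ S, ∀ y ∈ S, ∀ h : x ⟶ y,
      IsRestriction π (ρ.map h) (a x : E) (a y) := by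
  classical
  have : ∀ x : F, Finite {e : E // π.obj e = ρ.obj x} := fun x => (hpre (ρ.obj x)).to_subtype
  obtain ⟨Z, hZ⟩ := hram.exists_forall_finset (fun x => {e : E // π.obj e = ρ.obj x}) S B
  obtain ⟨q, hq⟩ := hπ.surj (ρ.obj Z)
  have hres : ∀ (x : F) (f : x ⟶ Z), ∃ e : {e : E // π.obj e = ρ.obj x},
      IsRestriction π (ρ.map f) (e : E) q := fun x f => by
    obtain ⟨e, he⟩ := hπ.exists_isRestriction (ρ.map f) hq
    exact ⟨⟨e, he.obj_eq⟩, he⟩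
  choose χ hχ using hres
  obtain ⟨g, hg⟩ := hZ χ
  choose e₀ he₀ using hπ.surj
  refine ⟨fun x => if h : Nonempty (x ⟶ B) then χ x (h.some ≫ g) else ⟨e₀ (ρ.obj x), he₀ _⟩,
    fun x hx y hy h => ?_⟩
  beta_reduce
  rw [dif_pos (hB x hx), dif_pos (hB y hy), hg x hx _ (h ≫ (hB y hy).some), Category.assoc]
  obtain ⟨e, he⟩ := hπ.exists_isRestriction (ρ.map h) (χ y ((hB y hy).some ≫ g)).2
  have hcomp := he.comp (hχ y ((hB y hy).some ≫ g))
  rw [← ρ.map_comp] at hcomp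
  rwa [hπ.isRestriction_unique (hχ x _) hcomp]

theorem exists_compatible_finset (hπ : IsExpansion π) (hpre : Precompact π) (ρ : F ⥤ C)
    (hconf : Confluent F) (hram : RamseyProp F) (S : Finset F) :
    ∃ a : ∀ x : F, {e : E // π.obj e = ρ.obj x}, ∀ x ∈ S, ∀ y ∈ S, ∀ h : x ⟶ y,
      IsRestriction π (ρ.map h) (a x : E) (a y) := by
  classical
  have hloc : ∀ k : ConnectedComponents F, ∃ a : ∀ x : F, {e : E // π.obj e = ρ.obj x},
      ∀ x ∈ S, Quotient.mk _ x = k → ∀ y ∈ S, Quotient.mk _ y = k → ∀ h : x ⟶ y,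
        IsRestriction π (ρ.map h) (a x : E) (a y) := by
    intro k
    induction k using Quotient.inductionOn with | _ X
    obtain ⟨B, -, hB⟩ := hconf.exists_cocone_finset X (S.filter (Zigzag X)) (by simp)
    obtain ⟨a, ha⟩ := exists_compatible_of_cocone hπ hpre ρ hram _ B hB
    refine ⟨a, fun x hx hxX y hy hyX h => ha x ?_ y ?_ h⟩
    · exact Finset.mem_filter.mpr ⟨hx, Quotient.exact hxX.symm⟩
    · exact Finset.mem_filter.mpr ⟨hy, Quotient.exact hyX.symm⟩
  choose a ha using hloc
  refine ⟨fun x => a (Quotient.mk _ x) x, fun x hx y hy h => ?_⟩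
  have hxy : (Quotient.mk (Zigzag.setoid F) x) = Quotient.mk _ y := Quotient.sound (Zigzag.of_hom h)
  simp only [hxy]
  exact ha _ x hx hxy y hy rfl h

/-- A confluent Ramsey category over `C` maps to every precompact expansion of `C`. -/
theorem exists_homomorphism (hπ : IsExpansion π) (hpre : Precompact π) (ρ : F ⥤ C)
    (hconf : Confluent F) (hram : RamseyProp F) : ∃ α : F ⥤ E, α ⋙ π = ρ := by
  classical
  have : ∀ x : F, Finite {e : E // π.obj e = ρ.obj x} := fun x => (hpre (ρ.obj x)).to_subtype
  choose g hg using exists_compatible_finset hπ hpre ρ hconf hram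
  obtain ⟨χ, hχ⟩ := Finset.rado_selection g
  obtain ⟨α, hα, -⟩ := hπ.exists_functor ρ (fun x => (χ x : E)) fun {x y} h => by
    obtain ⟨t, hst, ht⟩ := hχ {x, y}
    rw [ht x (by simp), ht y (by simp)]
    exact hg t x (hst (by simp)) y (hst (by simp)) h
  exact ⟨α, hα⟩

end Homomorphism

theorem ExpansionProperty.surjective_of_comp_eq {C E F : Type*} [Category* C] [Category* E]
    [Category* F] {π : E ⥤ C} {ρ : F ⥤ C} (hπ : IsExpansion π) (hep : ExpansionProperty π)
    (hρ : IsExpansion ρ) {α : F ⥤ E} (hα : α ⋙ π = ρ) : Function.Surjective α.obj := by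
  intro e
  obtain ⟨c', hc'⟩ := hep (π.obj e)
  obtain ⟨x, hx⟩ := hρ.surj c'
  have hxe : ρ.obj x = π.obj (α.obj x) := by rw [← hα]; rfl
  obtain ⟨φ⟩ := hc' e (α.obj x) rfl (by rw [← hxe, hx])
  obtain ⟨y, hy⟩ := hρ.exists_isRestriction (π.map φ) hxe
  exact ⟨y, hπ.isRestriction_unique (hy.map_of_comp_eq hα) (.map π φ)⟩

theorem ExpansionProperty.confluent {C E : Type*} [Category* C] [Category* E] {π : E ⥤ C}
    (hπ : IsExpansion π) (hep : ExpansionProperty π) (hC : Confluent C) : Confluent E := by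
  intro A B hAB
  obtain ⟨a, ha⟩ := hep (π.obj A)
  obtain ⟨b, hb⟩ := hep (π.obj B)
  obtain ⟨x, rfl⟩ := hπ.surj a
  obtain ⟨y, rfl⟩ := hπ.surj b
  obtain ⟨f⟩ := ha A x rfl rfl
  obtain ⟨g⟩ := hb B y rfl rfl
  have hxy : Zigzag x y :=
    (zigzag_symm.symm _ _ (Zigzag.of_hom f)).trans (hAB.trans (Zigzag.of_hom g))
  obtain ⟨c, p, q, -⟩ := hC _ _ (zigzag_obj_of_zigzag π hxy)
  obtain ⟨z, rfl⟩ := hπ.surj c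
  obtain ⟨x', hx'⟩ := hπ.exists_isRestriction p rfl
  obtain ⟨y', hy'⟩ := hπ.exists_isRestriction q rfl
  obtain ⟨f'⟩ := ha A x' rfl hx'.obj_eq
  obtain ⟨g'⟩ := hb B y' rfl hy'.obj_eq
  exact ⟨z, f' ≫ hx'.choose, g' ≫ hy'.choose, trivial⟩

/-- A surjective endomorphism over `C` of a family with finite fibers is injective. -/
theorem injective_of_surjective_of_finite_fibers {X C : Type*} (p : X → C)
    (hp : ∀ c, {x | p x = c}.Finite) (a : X → X) (ha : ∀ x, p (a x) = p x)
    (hsurj : Function.Surjective a) : Function.Injective a := by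
  intro x y hxy
  have hpxy : p x = p y := by rw [← ha x, ← ha y, hxy]
  have := (hp (p y)).to_subtype
  let b : {x | p x = p y} → {x | p x = p y} := fun z => ⟨a z, (ha z).trans z.2⟩
  have hb : Function.Surjective b := fun ⟨z, hz⟩ => by
    obtain ⟨w, rfl⟩ := hsurj z
    exact ⟨⟨w, (ha w).symm.trans hz⟩, rfl⟩
  have hinj : Function.Injective b := Finite.injective_iff_surjective.mpr hb
  exact congrArg Subtype.val (hinj (Subtype.ext hxy : b ⟨x, hpxy⟩ = b ⟨y, rfl⟩))

section Subexpansion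

variable {E : Type u} {C : Type u'} [Category.{v} E] [Category.{v'} C]

/-- A sieve of objects of `E` meeting all fibers of `π`. -/
structure IsSubexpansion (π : E ⥤ C) (S : Set E) : Prop where
  mem_of_hom : ∀ {x y : E}, (x ⟶ y) → y ∈ S → x ∈ S
  surj : ∀ c : C, ∃ e ∈ S, π.obj e = c

theorem IsExpansion.exists_minimal_isSubexpansion {π : E ⥤ C} (hπ : IsExpansion π)
    (hpre : Precompact π) : ∃ S, Minimal (IsSubexpansion π) S := by
  refine zorn_superset {S | IsSubexpansion π S} fun K hK hchain => ?_
  obtain rfl | hne := K.eq_empty_or_nonempty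
  · exact ⟨Set.univ, ⟨fun _ _ => trivial, fun c => by simpa using hπ.surj c⟩, by simp⟩
  refine ⟨⋂₀ K, ⟨fun f hy S hS => (hK hS).mem_of_hom f (hy S hS), fun c => ?_⟩,
    fun S hS => Set.sInter_subset_of_mem hS⟩
  obtain ⟨S, hS, hmin⟩ : ∃ S ∈ K, ∀ T ∈ K,
      (S ∩ {e | π.obj e = c}).ncard ≤ (T ∩ {e | π.obj e = c}).ncard := by
    obtain ⟨S, hS, h⟩ := (measure fun S : Set E => (S ∩ {e | π.obj e = c}).ncard).wf.has_min K hne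
    exact ⟨S, hS, fun T hT => not_lt.mp (h T hT)⟩
  obtain ⟨e, heS, hec⟩ := (hK hS).surj c
  refine ⟨e, fun T hT => ?_, hec⟩
  obtain h | h := hchain.total hS hT
  · exact h heS
  · have := Set.eq_of_subset_of_ncard_le (Set.inter_subset_inter_left {e | π.obj e = c} h)
      (hmin T hT) ((hpre c).inter_of_right S)
    exact (this.symm ▸ ⟨heS, hec⟩ : e ∈ T ∩ {e | π.obj e = c}).1

variable {π : E ⥤ C} {S : Set E}

theorem IsSubexpansion.isExpansion (hS : IsSubexpansion π S) (hπ : IsExpansion π) :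
    IsExpansion (ObjectProperty.ι (· ∈ S) ⋙ π) where
  surj c := by
    obtain ⟨e, heS, he⟩ := hS.surj c
    exact ⟨⟨e, heS⟩, he⟩
  fib := by
    rintro ⟨e, heS⟩ c f
    obtain ⟨⟨e', φ⟩, ⟨h, hφ⟩, huniq⟩ := hπ.fib e c f
    refine ⟨⟨⟨e', hS.mem_of_hom φ heS⟩, ObjectProperty.homMk φ⟩, ⟨h, hφ⟩, ?_⟩
    rintro ⟨⟨x, _⟩, ⟨ψ⟩⟩ ⟨h', hψ⟩
    obtain ⟨⟩ := huniq ⟨x, ψ⟩ ⟨h', hψ⟩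
    rfl

theorem Precompact.subexpansion (hpre : Precompact π) (S : Set E) :
    Precompact (ObjectProperty.ι (· ∈ S) ⋙ π) := fun c =>
  (hpre c).preimage (f := ObjectProperty.FullSubcategory.obj)
    fun _ _ _ _ h => ObjectProperty.FullSubcategory.ext h

theorem Minimal.expansionProperty (hS : Minimal (IsSubexpansion π) S) (hπ : IsExpansion π)
    (hpre : Precompact π) (hC : Confluent C) :
    ExpansionProperty (ObjectProperty.ι (· ∈ S) ⋙ π) := by
  classical
  intro c
  have hbelow : ∀ e ∈ S, ∃ d, ∀ x ∈ S, π.obj x = d → Nonempty (e ⟶ x) := by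
    intro e he
    by_contra! hd
    have hT : IsSubexpansion π {x ∈ S | IsEmpty (e ⟶ x)} :=
      ⟨fun f hy => ⟨hS.prop.mem_of_hom f hy.1, ⟨fun g => hy.2.false (g ≫ f)⟩⟩, fun d => by
        obtain ⟨x, hx, hxd, h⟩ := hd d
        exact ⟨x, ⟨hx, h⟩, hxd⟩⟩
    exact (hS.le_of_le hT (Set.sep_subset _ _) he).2.false (𝟙 e)
  have : Nonempty C := ⟨c⟩
  choose! d hd using hbelow
  have hcd : ∀ e ∈ S, Zigzag (π.obj e) (d e) := fun e he => by
    obtain ⟨x, hx, hxd⟩ := hS.prop.surj (d e)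
    obtain ⟨f⟩ := hd e he x hx hxd
    exact hxd ▸ Zigzag.of_hom (π.map f)
  have hfin : (S ∩ {e | π.obj e = c}).Finite := (hpre c).inter_of_right S
  obtain ⟨z, -, hz⟩ := hC.exists_cocone_finset c (hfin.toFinset.image d) (by
    simp only [Finset.mem_image, Set.Finite.mem_toFinset]
    rintro _ ⟨e, ⟨he, rfl⟩, rfl⟩
    exact hcd e he)
  refine ⟨z, ?_⟩
  rintro ⟨e, he⟩ ⟨x, hx⟩ hec hxz
  obtain ⟨f⟩ := hz (d e) (Finset.mem_image_of_mem d (hfin.mem_toFinset.mpr ⟨he, hec⟩))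
  obtain ⟨y, hy⟩ := hπ.exists_isRestriction f hxz
  obtain ⟨g⟩ := hd e he y (hS.prop.mem_of_hom hy.choose hx) hy.obj_eq
  exact ⟨ObjectProperty.homMk (g ≫ hy.choose)⟩

end Subexpansion

/-- A minimal subexpansion of a confluent Ramsey expansion is Ramsey. -/
theorem Minimal.ramseyProp {C : Type u'} [Category.{v'} C] {E : Type} [Category.{v} E]
    {π : E ⥤ C} {S : Set E} (hS : Minimal (IsSubexpansion π) S) (hπ : IsExpansion π)
    (hpre : Precompact π) (hconf : Confluent E) (hram : RamseyProp E) :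
    RamseyProp (ObjectProperty.FullSubcategory (· ∈ S)) := by
  have hπS := hS.prop.isExpansion hπ
  obtain ⟨α, hα⟩ := exists_homomorphism hπS (hpre.subexpansion S) π hconf hram
  have hobj : ∀ x, π.obj (α.obj x).obj = π.obj x := Functor.congr_obj hα
  have hsurj : ∀ s, ∃ t ∈ S, α.obj t = s := by
    have hT : IsSubexpansion π {e | ∃ t ∈ S, (α.obj t).obj = e} := by
      refine ⟨?_, fun c => ?_⟩
      · rintro x _ f ⟨t, ht, rfl⟩
        obtain ⟨y, hy⟩ := hπ.exists_isRestriction (π.map f) (hobj t).symm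
        have hx := IsRestriction.map (ObjectProperty.ι (· ∈ S) ⋙ π) (ObjectProperty.homMk f :
          (⟨x, hS.prop.mem_of_hom f (α.obj t).property⟩ : ObjectProperty.FullSubcategory (· ∈ S)) ⟶
            α.obj t)
        exact ⟨y, hS.prop.mem_of_hom hy.choose ht, congrArg ObjectProperty.FullSubcategory.obj
          (hπS.isRestriction_unique (hy.map_of_comp_eq hα) hx)⟩
      · obtain ⟨t, ht, rfl⟩ := hS.prop.surj c
        exact ⟨_, ⟨t, ht, rfl⟩, hobj t⟩
    rintro ⟨s, hs⟩
    have hTS : {e | ∃ t ∈ S, (α.obj t).obj = e} ⊆ S := by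
      rintro _ ⟨t, -, rfl⟩
      exact (α.obj t).property
    obtain ⟨t, ht, rfl⟩ := hS.le_of_le hT hTS hs
    exact ⟨t, ht, rfl⟩
  have hinj := injective_of_surjective_of_finite_fibers _ (hpre.subexpansion S)
    (fun t => α.obj t.obj) (fun t => hobj t.obj) fun s => by
      obtain ⟨t, ht, rfl⟩ := hsurj s
      exact ⟨⟨t, ht⟩, rfl⟩
  have hfull : ∀ x ∈ S, ∀ y ∈ S, ∀ f : α.obj x ⟶ α.obj y, ∃ φ : x ⟶ y, α.map φ = f := by
    intro x hx y hy f
    obtain ⟨x', φ, hφ⟩ := hπ.exists_isRestriction (π.map f.hom) (hobj y).symm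
    have hf := IsHomLift.map (ObjectProperty.ι (· ∈ S) ⋙ π) f
    have hαφ : (ObjectProperty.ι (· ∈ S) ⋙ π).IsHomLift (π.map f.hom) (α.map φ) :=
      isHomLift_map_of_comp_eq hα hφ
    have hx' : (⟨x', hS.prop.mem_of_hom φ hy⟩ : ObjectProperty.FullSubcategory (· ∈ S)) =
        ⟨x, hx⟩ := hinj (congrArg Sigma.fst (hπS.sigma_eq _ _ hαφ hf))
    obtain rfl : x' = x := congrArg ObjectProperty.FullSubcategory.obj hx'
    exact ⟨φ, hπS.hom_ext _ hαφ hf⟩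
  intro A B N _
  obtain ⟨A, hA, rfl⟩ := hsurj A
  obtain ⟨B, hB, rfl⟩ := hsurj B
  obtain ⟨Z, hZ⟩ := hram A B N inferInstance
  refine ⟨α.obj Z, fun χ => ?_⟩
  obtain ⟨g, hg⟩ := hZ fun f => χ (α.map f)
  refine ⟨α.map g, fun f f' => ?_⟩
  obtain ⟨φ, rfl⟩ := hfull A hA B hB f
  obtain ⟨φ', rfl⟩ := hfull A hA B hB f'
  simpa using hg φ φ'

theorem minimal_ramsey_expansion
    (C : Type) [SmallCategory C]
    (hClf : ∀ A B : C, Finite (A ⟶ B)) (hCconf : Confluent C)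
    (E₀ : Type) (instE₀ : SmallCategory E₀) (π₀ : E₀ ⥤ C)
    (hπ₀ : IsExpansion π₀) (hpre₀ : Precompact π₀)
    (hconf₀ : Confluent E₀) (hram₀ : RamseyProp E₀) :
    ∃ (E : Type) (_ : SmallCategory E) (π : E ⥤ C),
      IsExpansion π ∧ Precompact π ∧ Confluent E ∧ RamseyProp E ∧
        ExpansionProperty π ∧
        -- uniqueness up to isomorphism of expansions
        (∀ (E' : Type) (_ : SmallCategory E') (π' : E' ⥤ C),
          IsExpansion π' → Precompact π' → Confluent E' → RamseyProp E' →
            ExpansionProperty π' →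
              ∃ α : E' ⥤ E, α ⋙ π = π' ∧ Function.Bijective α.obj) ∧
        -- minimality
        (∀ (F : Type) (_ : SmallCategory F) (ρ : F ⥤ C),
          IsExpansion ρ → Precompact ρ → Confluent F → RamseyProp F →
            ∃ α : F ⥤ E, α ⋙ π = ρ ∧ Function.Surjective α.obj) := by
  obtain ⟨S, hS⟩ := hπ₀.exists_minimal_isSubexpansion hpre₀
  have hπ := hS.prop.isExpansion hπ₀
  have hpre := hpre₀.subexpansion S
  have hep := hS.expansionProperty hπ₀ hpre₀ hCconf
  have hconf := hep.confluent hπ hCconf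
  have hram := hS.ramseyProp hπ₀ hpre₀ hconf₀ hram₀
  refine ⟨ObjectProperty.FullSubcategory (· ∈ S), inferInstance, ObjectProperty.ι (· ∈ S) ⋙ π₀,
    hπ, hpre, hconf, hram, hep, ?_, ?_⟩
  · intro E' _ π' hπ' hpre' hconf' hram' hep'
    obtain ⟨α, hα⟩ := exists_homomorphism hπ hpre π' hconf' hram'
    obtain ⟨β, hβ⟩ := exists_homomorphism hπ' hpre' (ObjectProperty.ι (· ∈ S) ⋙ π₀) hconf hram
    have hαs := hep.surjective_of_comp_eq hπ hπ' hα
    have hβs := hep'.surjective_of_comp_eq hπ' hπ hβ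
    have hinj := injective_of_surjective_of_finite_fibers π'.obj hpre' (β.obj ∘ α.obj)
      (fun x => by
        have h := Functor.congr_obj hβ (α.obj x)
        exact h.trans (Functor.congr_obj hα x)) (hβs.comp hαs)
    exact ⟨α, hα, hinj.of_comp, hαs⟩
  · intro F _ ρ hρ _ hconfρ hramρ
    obtain ⟨α, hα⟩ := exists_homomorphism hπ hpre ρ hconfρ hramρ
    exact ⟨α, hα, hep.surjective_of_comp_eq hπ hρ hα⟩
end

section
/- Let B be a small, locally finite, confluent category with the Ramsey property and let C be a small, locally finite category. Suppose there are functors F : C ⥤ B and G : B ⥤ C and a natural transformation Δ : 𝟭_C ⟶ F ⋙ G (from the identity functor on C to the composite G ∘ F). Then C is confluent and has the Ramsey property. -/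
open CategoryTheory Opposite

universe v u v' u'

/-- Confluence transfers along functors `F`, `G` with a natural transformation `𝟭 C ⟶ F ⋙ G`. -/
theorem Confluent.of_natTrans {B : Type u} {C : Type u'} [Category.{v} B] [Category.{v'} C]
    (hB : Confluent B) (F : C ⥤ B) (G : B ⥤ C) (Δ : 𝟭 C ⟶ F ⋙ G) : Confluent C := by
  intro X Y h
  obtain ⟨Z, p, q, -⟩ := hB _ _ (zigzag_obj_of_zigzag F h)
  exact ⟨G.obj Z, Δ.app X ≫ G.map p, Δ.app Y ≫ G.map q, trivial⟩

/-- The Ramsey property transfers along functors `F`, `G` with a natural transformation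
`𝟭 C ⟶ F ⋙ G`. -/
theorem RamseyProp.of_natTrans {B : Type u} {C : Type u'} [Category.{v} B] [Category.{v'} C]
    (hB : RamseyProp B) (F : C ⥤ B) (G : B ⥤ C) (Δ : 𝟭 C ⟶ F ⋙ G) : RamseyProp C := by
  intro X Y N hN
  obtain ⟨Z, hZ⟩ := hB (F.obj X) (F.obj Y) N hN
  refine ⟨G.obj Z, fun χ => ?_⟩
  obtain ⟨g, hg⟩ := hZ fun h => χ (Δ.app X ≫ G.map h)
  have key (f : X ⟶ Y) : f ≫ Δ.app Y ≫ G.map g = Δ.app X ≫ G.map (F.map f ≫ g) := by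
    have := Δ.naturality_assoc f (G.map g)
    simpa using this
  refine ⟨Δ.app Y ≫ G.map g, fun f f' => ?_⟩
  rw [key f, key f']
  exact hg (F.map f) (F.map f')

theorem trivial_transfer
    (B C : Type) [SmallCategory B] [SmallCategory C]
    (hBlf : ∀ A A' : B, Finite (A ⟶ A'))
    (hBconf : Confluent B) (hBram : RamseyProp B)
    (hClf : ∀ A A' : C, Finite (A ⟶ A'))
    (F : C ⥤ B) (G : B ⥤ C) (Δ : 𝟭 C ⟶ F ⋙ G) :
    Confluent C ∧ RamseyProp C := by
  exact ⟨hBconf.of_natTrans F G Δ, hBram.of_natTrans F G Δ⟩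
end

section
/- Let π : E ⥤ C be an expansion with E small, locally finite, confluent and Ramsey, and let ρ : F ⥤ C be a core expansion of C (with F small and locally finite) such that there exist homomorphisms of expansions α : F ⥤ E (π ∘ α = ρ) and β : E ⥤ F (ρ ∘ β = π). Then F is confluent and has the Ramsey property. -/
open CategoryTheory Opposite

universe v u v' u'

/-- An expansion is a core if all of its endomorphisms are bijective on objects. -/
def IsCore {E : Type u} {C : Type u'} [Category.{v} E] [Category.{v'} C]
    (π : E ⥤ C) : Prop :=
  ∀ α : E ⥤ E, α ⋙ π = π → Function.Bijective α.obj

/-- Discrete fibrations are faithful. -/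
theorem IsExpansion.faithful {E : Type u} {C : Type u'} [Category.{v} E] [Category.{v'} C]
    {π : E ⥤ C} (hπ : IsExpansion π) : π.Faithful where
  map_injective {X Y f g} h := by
    have key := (hπ.fib Y (π.obj X) (π.map f)).unique
      (y₁ := ⟨X, f⟩) (y₂ := ⟨X, g⟩) ⟨rfl, by simp⟩ ⟨rfl, by simp [h]⟩
    simpa using key

/-- An endomorphism of an expansion that is injective on objects is full. -/
theorem IsExpansion.full_of_injective {E : Type u} {C : Type u'} [Category.{v} E]
    [Category.{v'} C] {π : E ⥤ C} (hπ : IsExpansion π) (γ : E ⥤ E) (hγ : γ ⋙ π = π)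
    (hinj : Function.Injective γ.obj) : γ.Full where
  map_surjective {X Y} h := by
    have hobj (x : E) : π.obj (γ.obj x) = π.obj x := Functor.congr_obj hγ x
    obtain ⟨⟨X', p⟩, ⟨hX', hp⟩, -⟩ := hπ.fib Y (π.obj X)
      (eqToHom (hobj X).symm ≫ π.map h ≫ eqToHom (hobj Y))
    have hmap : π.map (γ.map p) = eqToHom (hobj X') ≫ π.map p ≫ eqToHom (hobj Y).symm :=
      Functor.congr_hom hγ p
    have key := (hπ.fib (γ.obj Y) _ (π.map h)).unique
      (y₁ := ⟨γ.obj X', γ.map p⟩) (y₂ := ⟨γ.obj X, h⟩)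
      ⟨(hobj X').trans (hX'.trans (hobj X).symm), by
        dsimp only at hp
        simp [hmap, hp]⟩ ⟨rfl, by simp⟩
    obtain rfl : X' = X := hinj (congrArg Sigma.fst key)
    exact ⟨p, by simpa using key⟩

/-- Confluence passes to a category which is a retract up to equivalence. -/
theorem Confluent.of_comp_isEquivalence {E : Type u} {F : Type u'} [Category.{v} E]
    [Category.{v'} F] (hE : Confluent E) (α : F ⥤ E) (β : E ⥤ F) [(α ⋙ β).IsEquivalence] :
    Confluent F := by
  intro A B hAB
  obtain ⟨Z, a, b, -⟩ := hE _ _ (zigzag_obj_of_zigzag α hAB)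
  let i := (α ⋙ β).objObjPreimageIso (β.obj Z)
  exact ⟨_, (α ⋙ β).preimage (β.map a ≫ i.inv), (α ⋙ β).preimage (β.map b ≫ i.inv), trivial⟩

/-- The Ramsey property passes to a category which is a retract up to equivalence. -/
theorem RamseyProp.of_comp_isEquivalence {E : Type u} {F : Type u'} [Category.{v} E]
    [Category.{v'} F] (hE : RamseyProp E) (α : F ⥤ E) (β : E ⥤ F) [(α ⋙ β).IsEquivalence] :
    RamseyProp F := by
  intro A B N hN
  obtain ⟨Z, hZ⟩ := hE (α.obj A) (α.obj B) N hN
  let i := (α ⋙ β).objObjPreimageIso (β.obj Z)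
  refine ⟨(α ⋙ β).objPreimage (β.obj Z), fun χ => ?_⟩
  obtain ⟨g, hg⟩ := hZ fun h => χ ((α ⋙ β).preimage (X := A) (β.map h ≫ i.inv))
  have hcomp (f : A ⟶ B) : f ≫ (α ⋙ β).preimage (β.map g ≫ i.inv) =
      (α ⋙ β).preimage (β.map (α.map f ≫ g) ≫ i.inv) :=
    (α ⋙ β).map_injective (by rw [Functor.map_comp]; simp only [Functor.map_preimage]; simp)
  refine ⟨(α ⋙ β).preimage (β.map g ≫ i.inv), fun f f' => ?_⟩
  rw [hcomp, hcomp]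
  exact hg (α.map f) (α.map f')

theorem core_of_ramsey_expansion_is_ramsey
    (C E F : Type) [SmallCategory C] [SmallCategory E] [SmallCategory F]
    (π : E ⥤ C) (ρ : F ⥤ C)
    (hπ : IsExpansion π) (hρ : IsExpansion ρ)
    (hElf : ∀ A B : E, Finite (A ⟶ B))
    (hEconf : Confluent E) (hEram : RamseyProp E)
    (hFlf : ∀ A B : F, Finite (A ⟶ B))
    (hcore : IsCore ρ)
    (α : F ⥤ E) (hα : α ⋙ π = ρ)
    (β : E ⥤ F) (hβ : β ⋙ ρ = π) :
    Confluent F ∧ RamseyProp F := by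
  have hγ : (α ⋙ β) ⋙ ρ = ρ := by rw [Functor.assoc, hβ, hα]
  have hbij := hcore _ hγ
  have := hρ.faithful
  have : (α ⋙ β).Faithful := Functor.Faithful.of_comp_eq hγ
  have : (α ⋙ β).Full := hρ.full_of_injective _ hγ hbij.injective
  have : (α ⋙ β).EssSurj := Functor.essSurj_of_surj hbij.surjective
  have : (α ⋙ β).IsEquivalence := {}
  exact ⟨hEconf.of_comp_isEquivalence α β, hEram.of_comp_isEquivalence α β⟩
end

section
/- Let R be a small, locally finite, confluent category with the Ramsey property and let S : R ⥤ Cat be a functor such that for every object r of R the category S(r) is small, locally finite, confluent and has the Ramsey property, and such that the Grothendieck construction ∫S is locally finite. Then the Grothendieck construction ∫S (objects: pairs (r, s) with r ∈ R and s ∈ S(r); morphisms (r, s) ⟶ (r', s'): pairs (f, φ) with f : r ⟶ r' in R and φ : S(f)(s) ⟶ s' in S(r')) is confluent and has the Ramsey property. -/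
open CategoryTheory Opposite

universe v u v' u'

section FiniteFamilies

/-- In a category with the Ramsey property, finitely many colorings can be made constant
simultaneously. -/
theorem RamseyProp.exists_forall_mem {C : Type u} [Category.{v} C] (hC : RamseyProp C)
    {ι : Type*} (X : ι → C) (N : Type) [Finite N] (s : Finset ι) (B : C) :
    ∃ Z : C, ∀ χ : ∀ i, (X i ⟶ Z) → N, ∃ g : B ⟶ Z,
      ∀ i ∈ s, ∀ f f₂ : X i ⟶ B, χ i (f ≫ g) = χ i (f₂ ≫ g) := by
  classical
  induction s using Finset.induction_on with
  | empty => exact ⟨B, fun _ => ⟨𝟙 B, by simp⟩⟩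
  | insert a s _ ih =>
    obtain ⟨Y, hY⟩ := ih
    obtain ⟨Z, hZ⟩ := hC (X a) Y N ‹_›
    refine ⟨Z, fun χ => ?_⟩
    obtain ⟨h, hh⟩ := hZ (χ a)
    obtain ⟨g, hg⟩ := hY fun i f => χ i (f ≫ h)
    refine ⟨g ≫ h, fun i hi f f₂ => ?_⟩
    simp only [← Category.assoc]
    rcases Finset.mem_insert.1 hi with rfl | hi
    · exact hh _ _
    · exact hg i hi f f₂

/-- In a confluent category, finitely many objects of one connected component admit a cocone. -/
theorem Confluent.exists_forall_mem {C : Type u} [Category.{v} C] (hC : Confluent C)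
    {ι : Type*} (Y : ι → C) (b : C) (s : Finset ι) :
    ∃ Z : C, Nonempty (b ⟶ Z) ∧ ∀ i ∈ s, Zigzag b (Y i) → Nonempty (Y i ⟶ Z) := by
  classical
  induction s using Finset.induction_on with
  | empty => exact ⟨b, ⟨𝟙 b⟩, by simp⟩
  | insert a s _ ih =>
    obtain ⟨W, ⟨p⟩, hW⟩ := ih
    by_cases ha : Zigzag b (Y a)
    · obtain ⟨Z, q, w, -⟩ := hC W (Y a) ((Zigzag.of_inv p).trans ha)
      refine ⟨Z, ⟨p ≫ q⟩, fun i hi hz => ?_⟩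
      rcases Finset.mem_insert.1 hi with rfl | hi
      · exact ⟨w⟩
      · exact (hW i hi hz).map (· ≫ q)
    · refine ⟨W, ⟨p⟩, fun i hi hz => ?_⟩
      rcases Finset.mem_insert.1 hi with rfl | hi
      · exact absurd hz ha
      · exact hW i hi hz

end FiniteFamilies

/-- A category is confluent as soon as every span can be completed to a (not necessarily
commutative) square. -/
theorem Confluent.of_span {C : Type u} [Category.{v} C]
    (h : ∀ {W X Y : C}, (W ⟶ X) → (W ⟶ Y) → ∃ (Z : C) (_ : X ⟶ Z) (_ : Y ⟶ Z), True) :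
    Confluent C := by
  intro A B hAB
  induction hAB with
  | refl => exact ⟨A, 𝟙 A, 𝟙 A, trivial⟩
  | tail _ hXY ih =>
    obtain ⟨Z, p, q, -⟩ := ih
    rcases hXY with ⟨⟨e⟩⟩ | ⟨⟨e⟩⟩
    · obtain ⟨W, i, j, -⟩ := h q e
      exact ⟨W, p ≫ i, j, trivial⟩
    · exact ⟨Z, p, e ≫ q, trivial⟩

namespace CategoryTheory.Grothendieck

/-- A morphism in the Grothendieck construction, pushed forward along a morphism of the base,
connects the images of the source and target fibers. -/
theorem zigzag_of_hom {C : Type u} [Category.{v} C] {F : C ⥤ Cat.{v', u'}}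
    {X Y : Grothendieck F} (f : X ⟶ Y) {d : C} (u : Y.base ⟶ d) :
    Zigzag ((F.map (f.base ≫ u)).toFunctor.obj X.fiber) ((F.map u).toFunctor.obj Y.fiber) :=
  Zigzag.of_hom (eqToHom (by simp) ≫ (F.map u).toFunctor.map f.fiber)

/-- The Grothendieck construction of confluent categories over a confluent category with the
Ramsey property is confluent. -/
theorem confluent {C : Type u} [Category.{v} C] (hC : Confluent C) (hram : RamseyProp C)
    (F : C ⥤ Cat.{v', u'}) (hF : ∀ c, Confluent (F.obj c)) : Confluent (Grothendieck F) := by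
  refine Confluent.of_span fun {W X Y} f g => ?_
  obtain ⟨c, p, q, -⟩ := hC X.base Y.base
    ((Zigzag.of_inv f.base).trans (Zigzag.of_hom g.base))
  obtain ⟨d, hd⟩ := hram W.base c Prop inferInstance
  obtain ⟨v, hv⟩ := hd fun h => ∃ u : c ⟶ d,
    Zigzag ((F.map (f.base ≫ p ≫ u)).toFunctor.obj W.fiber) ((F.map h).toFunctor.obj W.fiber)
  have hpq := hv (f.base ≫ p) (g.base ≫ q)
  simp only [Category.assoc] at hpq
  obtain ⟨u, hu⟩ := hpq.mp ⟨v, Zigzag.refl _⟩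
  obtain ⟨z, i, j, -⟩ := hF d _ _
    (((zigzag_of_hom f (p ≫ u)).symm.trans hu).trans (zigzag_of_hom g (q ≫ v)))
  exact ⟨⟨d, z⟩, ⟨p ≫ u, i⟩, ⟨q ≫ v, j⟩, trivial⟩

/-- The Ramsey property of a category `C`, relative to objects `A`, `B` of a Grothendieck
construction over `C`, can be realized inside a single connected component of a fiber. -/
theorem exists_connectedComponent {C : Type u} [Category.{v} C] (hram : RamseyProp C)
    {F : C ⥤ Cat.{v', u'}} (A B : Grothendieck F) (N : Type) [Finite N] :
    ∃ (d : C) (b : F.obj d), ∀ χ : (A.base ⟶ d) → N, ∃ u : B.base ⟶ d,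
      Zigzag b ((F.map u).toFunctor.obj B.fiber) ∧
        ∀ f f₂ : A ⟶ B, χ (f.base ≫ u) = χ (f₂.base ≫ u) := by
  obtain ⟨d, hd⟩ := hram A.base B.base N ‹_›
  refine ⟨d, ?_⟩
  by_contra! hbad
  choose χ hχ using hbad
  let rep (x : F.obj d) : F.obj d := Quotient.out (s := Zigzag.setoid (F.obj d)) ⟦x⟧
  have rep_zigzag (x : F.obj d) : Zigzag (rep x) x :=
    Quotient.mk_out (s := Zigzag.setoid (F.obj d)) x
  have rep_eq {x y : F.obj d} (h : Zigzag x y) : rep x = rep y :=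
    congrArg (Quotient.out (s := Zigzag.setoid (F.obj d))) 
      (_root_.Quotient.sound (s := Zigzag.setoid (F.obj d)) h)
  obtain ⟨u, hu⟩ := hd fun h => χ (rep ((F.map h).toFunctor.obj A.fiber)) h
  obtain ⟨f, f₂, hne⟩ := hχ _ u (rep_zigzag _)
  apply hne
  have h := hu f.base f₂.base
  rwa [rep_eq (zigzag_of_hom f u), rep_eq (zigzag_of_hom f₂ u)] at h

/-- The Grothendieck construction of confluent categories with the Ramsey property over a locally
finite category with the Ramsey property has the Ramsey property. -/
theorem ramseyProp {C : Type u} [Category.{v} C] (hfin : ∀ A B : C, Finite (A ⟶ B))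
    (hram : RamseyProp C) (F : C ⥤ Cat.{v', u'}) (hF : ∀ c, Confluent (F.obj c))
    (hFram : ∀ c, RamseyProp (F.obj c)) : RamseyProp (Grothendieck F) := by
  intro A B N _
  rcases isEmpty_or_nonempty (A ⟶ B) with hAB | ⟨⟨e⟩⟩
  · exact ⟨B, fun _ => ⟨𝟙 B, fun f => hAB.elim f⟩⟩
  rcases isEmpty_or_nonempty N with hN | hN
  · exact ⟨B, fun χ => hN.elim (χ e)⟩
  obtain ⟨d, b, hd⟩ := exists_connectedComponent hram A B N
  have := Fintype.ofFinite (A.base ⟶ d)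
  have := Fintype.ofFinite (B.base ⟶ d)
  obtain ⟨t, -, ht⟩ := (hF d).exists_forall_mem
    (fun u : B.base ⟶ d => (F.map u).toFunctor.obj B.fiber) b Finset.univ
  obtain ⟨z, hz⟩ := (hFram d).exists_forall_mem
    (fun h : A.base ⟶ d => (F.map h).toFunctor.obj A.fiber) N Finset.univ t
  refine ⟨⟨d, z⟩, fun χ => ?_⟩
  obtain ⟨g, hg⟩ := hz fun h φ => χ ⟨h, φ⟩
  have hconst (h : A.base ⟶ d) :
      ∃ c : N, ∀ φ : (F.map h).toFunctor.obj A.fiber ⟶ t, χ ⟨h, φ ≫ g⟩ = c := by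
    rcases isEmpty_or_nonempty ((F.map h).toFunctor.obj A.fiber ⟶ t) with he | ⟨⟨φ⟩⟩
    · exact ⟨Classical.arbitrary N, fun φ => he.elim φ⟩
    · exact ⟨_, fun ψ => hg h (Finset.mem_univ h) ψ φ⟩
  choose c hc using hconst
  obtain ⟨u, hbu, hu⟩ := hd c
  obtain ⟨ψ⟩ := ht u (Finset.mem_univ u) hbu
  have key (f : A ⟶ B) : χ (f ≫ ⟨u, ψ ≫ g⟩) = c (f.base ≫ u) := by
    rw [← hc (f.base ≫ u) (eqToHom (by simp) ≫ (F.map u).toFunctor.map f.fiber ≫ ψ)]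
    congr 1
    exact Grothendieck.ext _ _ rfl ((Category.id_comp _).trans (by simp))
  exact ⟨⟨u, ψ ≫ g⟩, fun f f₂ => by rw [key, key, hu f f₂]⟩

end CategoryTheory.Grothendieck

theorem grothendieck_construction_ramsey
    (R : Type) [SmallCategory R]
    (hRlf : ∀ A B : R, Finite (A ⟶ B))
    (hRconf : Confluent R) (hRram : RamseyProp R)
    (S : R ⥤ Cat.{0, 0})
    (hfiblf : ∀ (r : R) (a b : S.obj r), Finite (a ⟶ b))
    (hfibconf : ∀ r : R, Confluent (S.obj r))
    (hfibram : ∀ r : R, RamseyProp (S.obj r))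
    (hlf : ∀ A B : Grothendieck S, Finite (A ⟶ B)) :
    Confluent (Grothendieck S) ∧ RamseyProp (Grothendieck S) := by
  exact ⟨Grothendieck.confluent hRconf hRram S hfibconf,
    Grothendieck.ramseyProp hRlf hRram S hfibconf hfibram⟩
end

section
/- Let C and D be small, locally finite, confluent categories with the Ramsey property. Then the product category C × D is confluent and has the Ramsey property. -/
open CategoryTheory Opposite

universe v u v' u'

theorem Confluent.prod {C : Type u} {D : Type u'} [Category.{v} C] [Category.{v'} D]
    (hC : Confluent C) (hD : Confluent D) : Confluent (C × D) := by
  intro A B h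
  obtain ⟨Z, a, b, -⟩ := hC _ _ (zigzag_obj_of_zigzag (CategoryTheory.Prod.fst C D) h)
  obtain ⟨W, a', b', -⟩ := hD _ _ (zigzag_obj_of_zigzag (CategoryTheory.Prod.snd C D) h)
  exact ⟨(Z, W), (a, a'), (b, b'), trivial⟩

/-- Color `A.1 ⟶ Z` by the induced colorings of `A.2 ⟶ W`, where `W` is a Ramsey witness in `D`;
only local finiteness of `D` is needed. -/
theorem RamseyProp.prod {C : Type u} {D : Type u'} [Category.{v} C] [Category.{0} D]
    (hDlf : ∀ A B : D, Finite (A ⟶ B)) (hC : RamseyProp C) (hD : RamseyProp D) :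
    RamseyProp (C × D) := by
  intro A B N _
  rcases isEmpty_or_nonempty (A.1 ⟶ B.1) with hAB | ⟨⟨f₀⟩⟩
  · exact ⟨B, fun _ => ⟨𝟙 B, fun f => hAB.elim f.1⟩⟩
  · obtain ⟨W, hW⟩ := hD A.2 B.2 N inferInstance
    have := hDlf A.2 W
    obtain ⟨Z, hZ⟩ := hC A.1 B.1 ((A.2 ⟶ W) → N) inferInstance
    refine ⟨(Z, W), fun χ => ?_⟩
    obtain ⟨g, hg⟩ := hZ fun f h => χ (f, h)
    obtain ⟨k, hk⟩ := hW fun h => χ (f₀ ≫ g, h)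
    refine ⟨(g, k), fun f f' => ?_⟩
    calc χ (f.1 ≫ g, f.2 ≫ k) = χ (f₀ ≫ g, f.2 ≫ k) := congrFun (hg f.1 f₀) _
      _ = χ (f₀ ≫ g, f'.2 ≫ k) := hk f.2 f'.2
      _ = χ (f'.1 ≫ g, f'.2 ≫ k) := congrFun (hg f₀ f'.1) _

theorem product_ramsey
    (C D : Type) [SmallCategory C] [SmallCategory D]
    (hClf : ∀ A B : C, Finite (A ⟶ B)) (hCconf : Confluent C) (hCram : RamseyProp C)
    (hDlf : ∀ A B : D, Finite (A ⟶ B)) (hDconf : Confluent D) (hDram : RamseyProp D) :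
    Confluent (C × D) ∧ RamseyProp (C × D) :=
  ⟨hCconf.prod hDconf, hCram.prod hDlf hDram⟩
end
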